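/- Let k be a finitely generated commutative ℂ-algebra, L and J unital finite type k-algebras, and φ: L → J a k-linear algebra homomorphism. Then φ is spectrum preserving if and only if φ⁻¹(Jac(J)) ⊆ Jac(L) and the induced morphism L/φ⁻¹(Jac(J)) → J/Jac(J) is spectrum preserving. -/

import Mathlib

/-- A primitive ideal of a unital ring `A`: a (two-sided) ideal which is the
annihilator of a simple left `A`-module. -/
def IsPrimitiveIdeal (A : Type) [Ring A] (P : Ideal A) : Prop :=
  ∃ (V : Type) (_ : AddCommGroup V) (_ : Module A V),
    IsSimpleModule A V ∧ P = Module.annihilator A V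

/-- The primitive ideal spectrum of a unital ring. -/
def PrimSpec (A : Type) [Ring A] : Type := {P : Ideal A // IsPrimitiveIdeal A P}

/-- The Jacobson radical: the intersection of all primitive ideals. -/
def jacRad (A : Type) [Ring A] : Ideal A := sInf {P : Ideal A | IsPrimitiveIdeal A P}

section SpectrumPreservingDefs
variable {k L J : Type} [CommRing k] [Ring L] [Ring J] [Algebra k L] [Algebra k J]

/-- `f` realizes the relation `R_φ = {(P', P) : φ⁻¹(P') ⊆ P}` as the graph of a
bijection `Prim(J) → Prim(L)`. -/
def IsGraphOf (φ : L →ₙₐ[k] J) (f : PrimSpec J → PrimSpec L) : Prop :=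
  Function.Bijective f ∧
    ∀ (P : PrimSpec J) (Q : PrimSpec L),
      ((⇑φ) ⁻¹' (P.1 : Set J) ⊆ (Q.1 : Set L)) ↔ f P = Q

/-- A `k`-linear (not necessarily unital) algebra morphism of unital `k`-algebras is
spectrum preserving iff `R_φ` is the graph of a bijection `Prim(J) → Prim(L)`. -/
def SpectrumPreserving (φ : L →ₙₐ[k] J) : Prop := ∃ f, IsGraphOf φ f

end SpectrumPreservingDefs

theorem jacRad_le {A : Type} [Ring A] (P : PrimSpec A) : jacRad A ≤ P.1 :=
  sInf_le P.2

theorem mem_jacRad {A : Type} [Ring A] {x : A} : x ∈ jacRad A ↔ ∀ P : PrimSpec A, x ∈ P.1 := by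
  simp only [jacRad, Submodule.mem_sInf, Set.mem_ofPred_eq]
  exact ⟨fun h P => h P.1 P.2, fun h P hP => h ⟨P, hP⟩⟩

section Surjective

variable {A B : Type} [Ring A] [Ring B]

/-- Primitive ideals pull back to primitive ideals along surjective ring homomorphisms. -/
theorem IsPrimitiveIdeal.comap (f : A →+* B) (hf : Function.Surjective f) {P : Ideal B}
    (hP : IsPrimitiveIdeal B P) : IsPrimitiveIdeal A (P.comap f) := by
  obtain ⟨V, _, _, hV, rfl⟩ := hP
  let : Module A V := Module.compHom V f
  have : RingHomSurjective f := ⟨hf⟩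
  let l : V →ₛₗ[f] V := { toFun := id, map_add' := fun _ _ => rfl, map_smul' := fun _ _ => rfl }
  refine ⟨V, inferInstance, inferInstance,
    (l.isSimpleModule_iff_of_bijective Function.bijective_id).2 hV, ?_⟩
  ext x
  simp only [Ideal.mem_comap, Module.mem_annihilator]
  rfl

/-- A primitive ideal containing the kernel of a surjective ring homomorphism is pulled back
from a primitive ideal of the codomain. -/
theorem IsPrimitiveIdeal.exists_comap_eq (f : A →+* B) (hf : Function.Surjective f) {Q : Ideal A}
    (hQ : IsPrimitiveIdeal A Q) (hker : RingHom.ker f ≤ Q) :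
    ∃ P, IsPrimitiveIdeal B P ∧ P.comap f = Q := by
  obtain ⟨V, _, _, hV, rfl⟩ := hQ
  let g : B →+* AddMonoid.End V := f.liftOfSurjective hf ⟨Module.toAddMonoidEnd A V, fun x hx => by
    ext v
    exact Module.mem_annihilator.1 (hker hx) v⟩
  have hg (x : A) (v : V) : g (f x) v = x • v :=
    DFunLike.congr_fun (f.liftOfRightInverse_comp_apply _ (Function.rightInverse_surjInv hf)
      ⟨Module.toAddMonoidEnd A V, _⟩ x) v
  let : Module B V := Module.compHom V g
  have : RingHomSurjective f := ⟨hf⟩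
  have hsmul (x : A) (v : V) : f x • v = x • v := hg x v
  let l : V →ₛₗ[f] V :=
    { toFun := id, map_add' := fun _ _ => rfl, map_smul' := fun x v => (hsmul x v).symm }
  refine ⟨_, ⟨V, inferInstance, inferInstance,
    (l.isSimpleModule_iff_of_bijective Function.bijective_id).1 hV, rfl⟩, ?_⟩
  ext x
  simp only [Ideal.mem_comap, Module.mem_annihilator, hsmul]

/-- A surjective ring homomorphism whose kernel lies in the Jacobson radical identifies the
primitive ideal spectra. -/
theorem exists_primSpec_equiv (f : A →+* B) (hf : Function.Surjective f)
    (hker : RingHom.ker f ≤ jacRad A) :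
    ∃ e : PrimSpec B ≃ PrimSpec A, ∀ P x, x ∈ (e P).1 ↔ f x ∈ P.1 := by
  let c : PrimSpec B → PrimSpec A := fun P => ⟨P.1.comap f, P.2.comap f hf⟩
  refine ⟨Equiv.ofBijective c ⟨fun P Q h => ?_, fun Q => ?_⟩, fun P x => Iff.rfl⟩
  · exact Subtype.ext (Ideal.comap_injective_of_surjective f hf (congrArg Subtype.val h))
  · obtain ⟨P, hP, h⟩ := Q.2.exists_comap_eq f hf (hker.trans (jacRad_le Q))
    exact ⟨⟨P, hP⟩, Subtype.ext h⟩

end Surjective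

section SpectrumPreserving

variable {k L J : Type} [CommRing k] [Ring L] [Ring J] [Algebra k L] [Algebra k J]

theorem SpectrumPreserving.mem_jacRad_of_map_mem {φ : L →ₙₐ[k] J} (h : SpectrumPreserving φ)
    {x : L} (hx : φ x ∈ jacRad J) : x ∈ jacRad L := by
  obtain ⟨f, hf, hgraph⟩ := h
  refine mem_jacRad.2 fun Q => ?_
  obtain ⟨P, rfl⟩ := hf.2 Q
  exact (hgraph P _).2 rfl (jacRad_le P hx)

/-- Being spectrum preserving only depends on the relation `R_φ` up to bijections of the
primitive ideal spectra. -/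
theorem spectrumPreserving_congr {L' J' : Type} [Ring L'] [Ring J'] [Algebra k L'] [Algebra k J']
    {φ : L →ₙₐ[k] J} {φ' : L' →ₙₐ[k] J'} (eL : PrimSpec L' ≃ PrimSpec L)
    (eJ : PrimSpec J' ≃ PrimSpec J)
    (h : ∀ P Q, φ ⁻¹' ((eJ P).1 : Set J) ⊆ ((eL Q).1 : Set L) ↔
      φ' ⁻¹' (P.1 : Set J') ⊆ (Q.1 : Set L')) :
    SpectrumPreserving φ ↔ SpectrumPreserving φ' := by
  constructor
  · rintro ⟨f, hf, hgraph⟩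
    refine ⟨eL.symm ∘ f ∘ eJ, eL.symm.bijective.comp (hf.comp eJ.bijective), fun P Q => ?_⟩
    rw [← h, hgraph, Function.comp_apply, Function.comp_apply, Equiv.symm_apply_eq]
  · rintro ⟨f, hf, hgraph⟩
    refine ⟨eL ∘ f ∘ eJ.symm, eL.bijective.comp (hf.comp eJ.symm.bijective), fun P Q => ?_⟩
    obtain ⟨P, rfl⟩ := eJ.surjective P
    obtain ⟨Q, rfl⟩ := eL.surjective Q
    rw [h, hgraph]
    simp

end SpectrumPreserving

/-- Corollary (cor.inj.J): `φ : L → J` is spectrum preserving iff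
`φ⁻¹(Jac(J)) ⊆ Jac(L)` and the induced morphism `L/φ⁻¹(Jac(J)) → J/Jac(J)` is spectrum
preserving (the quotients being presented as surjective images with the indicated
kernels). -/
theorem spectrumPreserving_iff_semiprimitive_quotient
    (k : Type) [CommRing k] [Algebra ℂ k] [Algebra.FiniteType ℂ k]
    (L J : Type) [Ring L] [Ring J] [Algebra k L] [Algebra k J]
    [Module.Finite k L] [Module.Finite k J]
    (φ : L →ₙₐ[k] J)
    (L' J' : Type) [Ring L'] [Ring J'] [Algebra k L'] [Algebra k J']
    (pL : L →ₐ[k] L') (pJ : J →ₐ[k] J') (φ' : L' →ₙₐ[k] J')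
    (hpL : Function.Surjective pL) (hpJ : Function.Surjective pJ)
    (hkerL : ∀ x : L, pL x = 0 ↔ φ x ∈ jacRad J)
    (hkerJ : ∀ y : J, pJ y = 0 ↔ y ∈ jacRad J)
    (hcomm : ∀ x : L, φ' (pL x) = pJ (φ x)) :
    SpectrumPreserving φ ↔
      ((∀ x : L, φ x ∈ jacRad J → x ∈ jacRad L) ∧ SpectrumPreserving φ') := by
  have hiff (hφ : ∀ x : L, φ x ∈ jacRad J → x ∈ jacRad L) :
      SpectrumPreserving φ ↔ SpectrumPreserving φ' := by
    obtain ⟨eL, heL⟩ := exists_primSpec_equiv (pL : L →+* L') hpL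
      fun x hx => hφ x ((hkerL x).1 hx)
    obtain ⟨eJ, heJ⟩ := exists_primSpec_equiv (pJ : J →+* J') hpJ
      fun y hy => (hkerJ y).1 hy
    refine spectrumPreserving_congr eL eJ fun P Q => ?_
    simp only [Set.subset_def, Set.mem_preimage, SetLike.mem_coe, heL, heJ, hpL.forall, hcomm,
      RingHom.coe_coe]
  exact ⟨fun h => ⟨fun _ => h.mem_jacRad_of_map_mem,
    (hiff fun _ => h.mem_jacRad_of_map_mem).1 h⟩, fun h => (hiff h.1).2 h.2⟩
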